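/- Let Ω ⊂ ℝ^N be an open bounded symmetric set with 0 ∈ Ω. Then the Krasnoselskii genus of its boundary ∂Ω equals N. -/

import Mathlib

open Set Classical in
/-- The Krasnoselskii genus of a closed symmetric subset of a Banach space. -/
noncomputable def krasnoselskiiGenus {E : Type*} [NormedAddCommGroup E] [NormedSpace ℝ E]
    (A : Set E) : ℕ∞ :=
  if A = ∅ then 0 else
    sInf {k : ℕ∞ | ∃ n : ℕ, k = (n : ℕ∞) ∧ 0 < n ∧
      ∃ f : E → EuclideanSpace ℝ (Fin n), ContinuousOn f A ∧
        (∀ x ∈ A, f (-x) = -f x) ∧ ∀ x ∈ A, f x ≠ 0}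

namespace Fan

/-- wedge of a 0-cochain with a cochain on ordered simplices (lists), mod 2 -/
def wd {V : Type*} (e : V → ZMod 2) : List V → (List V → ZMod 2) → ZMod 2
  | [], _ => 0
  | a :: l, φ => e a * φ l + wd e l (fun t => φ (a :: t))

section
variable {V : Type*}

theorem two_mul_zero (x : ZMod 2) : x + x = 0 := CharTwo.add_self_eq_zero x

theorem wd_congr (e : V → ZMod 2) (l : List V) : ∀ (φ ψ : List V → ZMod 2),
    (∀ t, t.Sublist l → φ t = ψ t) → wd e l φ = wd e l ψ := by
  induction l with
  | nil => intros; rfl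
  | cons a l ih =>
    intro φ ψ h
    simp only [wd]
    rw [h l (List.sublist_cons_self a l),
      ih (fun t => φ (a :: t)) (fun t => ψ (a :: t)) (fun t ht => h _ (ht.cons_cons a))]

theorem wd_congr_len (e : V → ZMod 2) (l : List V) : ∀ (φ ψ : List V → ZMod 2),
    (∀ t : List V, t.length + 1 = l.length → φ t = ψ t) → wd e l φ = wd e l ψ := by
  induction l with
  | nil => intros; rfl
  | cons a l ih =>
    intro φ ψ h
    simp only [wd]
    rw [h l (by simp),
      ih (fun t => φ (a :: t)) (fun t => ψ (a :: t)) (fun t ht => h _ (by simp [ht]))]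

theorem wd_congr_e (l : List V) : ∀ (e e' : V → ZMod 2) (φ : List V → ZMod 2),
    (∀ t ∈ l, e t = e' t) → wd e l φ = wd e' l φ := by
  induction l with
  | nil => intros; rfl
  | cons a l ih =>
    intro e e' φ h
    simp only [wd]
    rw [h a (by simp), ih e e' _ (fun t ht => h t (by simp [ht]))]

theorem wd_add (e : V → ZMod 2) (l : List V) : ∀ (φ ψ : List V → ZMod 2),
    wd e l (fun t => φ t + ψ t) = wd e l φ + wd e l ψ := by
  induction l with
  | nil => intros; simp [wd]
  | cons a l ih =>
    intro φ ψ
    simp only [wd, ih]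
    ring

theorem wd_zero (e : V → ZMod 2) (l : List V) : wd e l (fun _ => 0) = 0 := by
  induction l with
  | nil => rfl
  | cons a l ih => simp only [wd, ih]; ring

theorem wd_mul (c : ZMod 2) (e : V → ZMod 2) (l : List V) : ∀ (φ : List V → ZMod 2),
    wd e l (fun t => c * φ t) = c * wd e l φ := by
  induction l with
  | nil => intros; simp [wd]
  | cons a l ih =>
    intro φ
    simp only [wd, ih]
    ring

theorem wd_add_e (e e' : V → ZMod 2) (l : List V) : ∀ (φ : List V → ZMod 2),
    wd (fun v => e v + e' v) l φ = wd e l φ + wd e' l φ := by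
  induction l with
  | nil => intros; simp [wd]
  | cons a l ih =>
    intro φ
    simp only [wd, ih]
    ring

theorem wd_comm (e e' : V → ZMod 2) (l : List V) : ∀ (φ : List V → ZMod 2),
    wd e l (fun t => wd e' t φ) = wd e' l (fun t => wd e t φ) := by
  induction l with
  | nil => intros; simp [wd]
  | cons a l ih =>
    intro φ
    simp only [wd, wd_add, wd_mul, ih]
    ring

theorem wd_self (e : V → ZMod 2) (l : List V) : ∀ (φ : List V → ZMod 2),
    wd e l (fun t => wd e t φ) = 0 := by
  induction l with
  | nil => intros; simp [wd]
  | cons a l ih =>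
    intro φ
    simp only [wd, wd_add, wd_mul, ih]
    rw [← add_assoc, two_mul_zero, zero_add]

theorem wd_pq (e e' : V → ZMod 2) (l : List V) : ∀ (φ : List V → ZMod 2),
    (∀ a ∈ l, ∀ b ∈ l, e a * e' b = 0) →
    wd e l (fun t => wd e' t φ) = 0 := by
  induction l with
  | nil => intros; simp [wd]
  | cons a l ih =>
    intro φ h
    simp only [wd, wd_add, wd_mul]
    rw [ih _ (fun x hx y hy => h x (by simp [hx]) y (by simp [hy])), add_zero,
      ← wd_mul, ← wd_mul]
    have key : ∀ (c : ZMod 2) (f : V → ZMod 2) (k : List V) (ψ : List V → ZMod 2),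
        (∀ x ∈ k, c * f x = 0) → wd f k (fun t => c * ψ t) = 0 := by
      intro c f k ψ hk
      by_cases hc : c = 0
      · subst hc; simp [wd_zero]
      · rw [wd_congr_e k f (fun _ => 0) _ (fun x hx => by
          have := hk x hx
          rcases mul_eq_zero.1 this with h | h
          · exact absurd h hc
          · exact h)]
        have : ∀ (k : List V) (ψ : List V → ZMod 2), wd (fun _ : V => 0) k ψ = 0 := by
          intro k
          induction k with
          | nil => intros; rfl
          | cons a k ih => intro ψ; simp [wd, ih]
        exact this _ _
    rw [key _ _ _ _ (fun x hx => h a (by simp) x (by simp [hx])),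
      key _ _ _ _ (fun x hx => by rw [mul_comm]; exact h x (by simp [hx]) a (by simp)), add_zero]

theorem wd_perm (e : V → ZMod 2) {l l' : List V} (h : l.Perm l') : ∀ (φ : List V → ZMod 2),
    (∀ s t : List V, s.Perm t → φ s = φ t) → wd e l φ = wd e l' φ := by
  induction h with
  | nil => intros; rfl
  | cons a h ih =>
    intro φ hφ
    simp only [wd]
    rw [hφ _ _ h, ih _ (fun s t hst => hφ _ _ (hst.cons a))]
  | swap a b l =>
    intro φ hφ
    simp only [wd]
    have : (fun t => φ (b :: a :: t)) = (fun t => φ (a :: b :: t)) := by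
      funext t; exact hφ _ _ (List.Perm.swap a b t)
    rw [this]; ring
  | trans h1 h2 ih1 ih2 =>
    intro φ hφ
    rw [ih1 φ hφ, ih2 φ hφ]

theorem wd_map (τ : V → V) (e : V → ZMod 2) (l : List V) : ∀ (φ : List V → ZMod 2),
    wd e (l.map τ) φ = wd (fun v => e (τ v)) l (fun t => φ (t.map τ)) := by
  induction l with
  | nil => intros; rfl
  | cons a l ih => intro φ; simp [wd, ih]

/-- unit cochain -/
def one : List V → ZMod 2
  | [] => 1
  | _ :: _ => 0

/-- alternating cochains: starting with p and ending in p, resp. q -/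
def AB (p q : ℕ → V → ZMod 2) : ℕ → (List V → ZMod 2) × (List V → ZMod 2)
  | 0 => (fun _ => 0, fun _ => 0)
  | m + 1 => (fun l => (AB p q m).1 l + wd (p m) l (fun t => one t + (AB p q m).2 t),
      fun l => (AB p q m).2 l + wd (q m) l (AB p q m).1)

def uu (p q : ℕ → V → ZMod 2) : ℕ → V → ZMod 2
  | 0 => fun _ => 0
  | m + 1 => fun v => uu p q m v + (p m v + q m v)

theorem wd_zero_e (k : List V) : ∀ (ψ : List V → ZMod 2), wd (fun _ : V => 0) k ψ = 0 := by
  induction k with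
  | nil => intros; rfl
  | cons a k ih => intro ψ; simp [wd, ih]

theorem AB_main (p q : ℕ → V → ZMod 2) (m : ℕ) : ∀ (l : List V),
    (∀ j < m, ∀ a ∈ l, ∀ b ∈ l, p j a * q j b = 0) →
    wd (uu p q m) l (fun t => one t + (AB p q m).2 t) = (AB p q m).1 l + (AB q p m).1 l ∧
    wd (uu p q m) l (AB p q m).1 = (AB p q m).2 l + (AB q p m).2 l := by
  induction m with
  | zero => intro l h; simp [uu, AB, wd_zero_e]
  | succ m ih =>
    intro l h
    have hs : ∀ t : List V, t.Sublist l → (∀ j < m, ∀ a ∈ t, ∀ b ∈ t, p j a * q j b = 0) :=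
      fun t ht j hj a ha b hb => h j (by omega) a (ht.subset ha) b (ht.subset hb)
    have e1 : wd (uu p q m) l (fun t => one t + (AB p q m).2 t)
        = (AB p q m).1 l + (AB q p m).1 l := (ih l (hs l (List.Sublist.refl l))).1
    have e2 : wd (uu p q m) l (AB p q m).1
        = (AB p q m).2 l + (AB q p m).2 l := (ih l (hs l (List.Sublist.refl l))).2
    have f1 : ∀ e : V → ZMod 2, wd (uu p q m) l
        (fun t => wd e t (fun t => one t + (AB p q m).2 t)) =
        wd e l (AB p q m).1 + wd e l (AB q p m).1 := by
      intro e
      rw [wd_comm, ← wd_add]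
      exact wd_congr _ _ _ _ (fun t ht => (ih t (hs t ht)).1)
    have f2 : ∀ e : V → ZMod 2, wd (uu p q m) l (fun t => wd e t (AB p q m).1) =
        wd e l (AB p q m).2 + wd e l (AB q p m).2 := by
      intro e
      rw [wd_comm, ← wd_add]
      exact wd_congr _ _ _ _ (fun t ht => (ih t (hs t ht)).2)
    have hpq : ∀ φ, wd (p m) l (fun t => wd (q m) t φ) = 0 :=
      fun φ => wd_pq _ _ _ _ (h m (by omega))
    have hqp : ∀ φ, wd (q m) l (fun t => wd (p m) t φ) = 0 :=
      fun φ => by rw [wd_comm]; exact hpq φ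
    constructor
    · have : (fun t => one t + (AB p q (m+1)).2 t) =
          (fun t => (one t + (AB p q m).2 t) + wd (q m) t (AB p q m).1) := by
        funext t; simp only [AB]; ring
      rw [this]
      simp only [uu]
      rw [wd_add, wd_add_e, wd_add_e, wd_add_e, wd_add_e, e1, f2, hpq, wd_self]
      simp only [AB, wd_add]
      linear_combination two_mul_zero (wd (q m) l (AB p q m).2)
    · have : (AB p q (m+1)).1 =
          (fun t => (AB p q m).1 t + wd (p m) t (fun t => one t + (AB p q m).2 t)) := by
        funext t; simp only [AB]
      rw [this]
      simp only [uu]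
      rw [wd_add, wd_add_e, wd_add_e, wd_add_e, wd_add_e, e2, f1, hqp, wd_self]
      simp only [AB]
      linear_combination two_mul_zero (wd (p m) l (AB p q m).1)

def WW (p q : ℕ → V → ZMod 2) (m : ℕ) (l : List V) : ZMod 2 := (AB p q m).1 l + (AB p q m).2 l

theorem AB_nil (p q : ℕ → V → ZMod 2) (m : ℕ) : (AB p q m).1 [] = 0 ∧ (AB p q m).2 [] = 0 := by
  induction m with
  | zero => simp [AB]
  | succ m ih => simp [AB, ih, wd]

theorem AB_len (p q : ℕ → V → ZMod 2) (m : ℕ) : ∀ l : List V, m < l.length →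
    (AB p q m).1 l = 0 ∧ (AB p q m).2 l = 0 := by
  induction m with
  | zero => simp [AB]
  | succ m ih =>
    intro l hl
    simp only [AB]
    rw [(ih l (by omega)).1, (ih l (by omega)).2,
      wd_congr_len (p m) l _ (fun _ => 0), wd_congr_len (q m) l _ (fun _ => 0), wd_zero, wd_zero]
    · simp
    · intro t ht; exact (ih t (by omega)).1
    · intro t ht
      rw [(ih t (by omega)).2]
      cases t with
      | nil => simp at ht; omega
      | cons a t => simp [one]

theorem AB_perm (p q : ℕ → V → ZMod 2) (m : ℕ) : ∀ s t : List V, s.Perm t →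
    (AB p q m).1 s = (AB p q m).1 t ∧ (AB p q m).2 s = (AB p q m).2 t := by
  induction m with
  | zero => simp [AB]
  | succ m ih =>
    intro s t hst
    simp only [AB]
    rw [(ih s t hst).1, (ih s t hst).2, wd_perm _ hst, wd_perm (q m) hst]
    · simp
    · exact fun s t hst => (ih s t hst).1
    · intro s t hst
      rw [(ih s t hst).2]
      cases s with
      | nil => rw [List.nil_perm.1 hst]
      | cons a s =>
        cases t with
        | nil => simp at hst
        | cons b t => simp [one]

theorem AB_map (τ : V → V) (p q : ℕ → V → ZMod 2) (hpq : ∀ j v, p j (τ v) = q j v)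
    (hqp : ∀ j v, q j (τ v) = p j v) (m : ℕ) : ∀ l : List V,
    (AB p q m).1 (l.map τ) = (AB q p m).1 l ∧ (AB p q m).2 (l.map τ) = (AB q p m).2 l := by
  induction m with
  | zero => simp [AB]
  | succ m ih =>
    intro l
    simp only [AB]
    rw [(ih l).1, (ih l).2, wd_map, wd_map]
    simp only [hpq, hqp, (ih _).1, (ih _).2]
    have : ∀ t : List V, one (t.map τ) = one t := by intro t; cases t <;> rfl
    simp [this]

theorem WW_main (p q : ℕ → V → ZMod 2) (m : ℕ) (l : List V)
    (h : ∀ j < m, ∀ a ∈ l, ∀ b ∈ l, p j a * q j b = 0) (hu : ∀ a ∈ l, uu p q m a = 1)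
    (hl : 2 ≤ l.length) :
    wd (fun _ => 1) l (WW p q m) = WW p q m l + WW q p m l := by
  rw [← wd_congr_e l (uu p q m) (fun _ => 1) _ hu]
  have h0 : wd (uu p q m) l one = 0 := by
    rw [wd_congr_len _ l one (fun _ => 0), wd_zero]
    intro t ht
    cases t with
    | nil => simp at ht; omega
    | cons a t => rfl
  obtain ⟨h1, h2⟩ := AB_main p q m l h
  rw [wd_add, h0, zero_add] at h1
  have : WW p q m = fun l => (AB p q m).1 l + (AB p q m).2 l := rfl
  rw [this, wd_add, h1, h2]
  simp only [WW]; ring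

theorem WW_single (p q : ℕ → V → ZMod 2) (m : ℕ) (a : V)
    (h : ∀ j < m, p j a * q j a = 0) (hu : uu p q m a = 1) :
    WW p q m [a] + WW q p m [a] = 1 := by
  obtain ⟨h1, h2⟩ := AB_main p q m [a] (by simpa using h)
  simp only [wd, AB_nil, one, hu] at h1 h2
  simp only [WW]
  linear_combination - h1 - h2

theorem WW_len (p q : ℕ → V → ZMod 2) (m : ℕ) (l : List V) (hl : m < l.length) :
    WW p q m l = 0 := by simp [WW, AB_len p q m l hl]

theorem WW_perm (p q : ℕ → V → ZMod 2) (m : ℕ) (s t : List V) (h : s.Perm t) :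
    WW p q m s = WW p q m t := by simp only [WW, AB_perm p q m s t h]

theorem WW_map (τ : V → V) (p q : ℕ → V → ZMod 2) (hpq : ∀ j v, p j (τ v) = q j v)
    (hqp : ∀ j v, q j (τ v) = p j v) (m : ℕ) (l : List V) :
    WW p q m (l.map τ) = WW q p m l := by simp only [WW, AB_map τ p q hpq hqp m l]

end

section
variable {N : ℕ}

abbrev st (i : Fin N) : Fin N → ℤ := Pi.single i 1

def ind (S : Finset (Fin N)) : Fin N → ℤ := fun i => if i ∈ S then 1 else 0

theorem ind_erase (S : Finset (Fin N)) (i : Fin N) (hi : i ∈ S) :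
    ind S = ind (S.erase i) + st i := by
  funext j
  by_cases h : j = i
  · subst h; simp [ind, hi]
  · simp [ind, h]

/-- sum of a cochain over the Freudenthal triangulation of the cube at `x` in directions `S` -/
def II : ℕ → Finset (Fin N) → (Fin N → ℤ) → (List (Fin N → ℤ) → ZMod 2) → ZMod 2
  | 0, _, x, φ => φ [x]
  | n + 1, S, x, φ => ∑ i ∈ S, II n (S.erase i) (x + st i) (fun t => φ (x :: t))

theorem II_congr (n : ℕ) : ∀ (S : Finset (Fin N)) (x : Fin N → ℤ)
    (φ ψ : List (Fin N → ℤ) → ZMod 2),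
    (∀ l : List (Fin N → ℤ), l.length = n + 1 →
      (∀ v ∈ l, ∀ i, x i ≤ v i ∧ v i ≤ x i + ind S i) → φ l = ψ l) →
    II n S x φ = II n S x ψ := by
  induction n with
  | zero =>
    intro S x φ ψ h
    simp only [II]
    refine h _ (by simp) ?_
    intro v hv i
    simp only [List.mem_singleton] at hv
    subst hv
    simp only [ind]; split_ifs <;> omega
  | succ n ih =>
    intro S x φ ψ h
    simp only [II]
    refine Finset.sum_congr rfl fun i hi => ih _ _ _ _ fun l hl hv => h _ (by simp [hl]) ?_
    intro v hvl j
    rw [List.mem_cons] at hvl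
    rcases hvl with rfl | hvl
    · simp only [ind]; split_ifs <;> omega
    · have := hv v hvl j
      rw [ind_erase S i hi]
      have h2 : 0 ≤ (st i : Fin N → ℤ) j := by
        simp only [Pi.single_apply]; split_ifs <;> omega
      simp only [Pi.add_apply] at this ⊢
      omega

theorem II_add (n : ℕ) : ∀ (S : Finset (Fin N)) (x : Fin N → ℤ)
    (φ ψ : List (Fin N → ℤ) → ZMod 2),
    II n S x (fun t => φ t + ψ t) = II n S x φ + II n S x ψ := by
  induction n with
  | zero => intros; rfl
  | succ n ih =>
    intro S x φ ψ
    simp only [II, ih, Finset.sum_add_distrib]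

theorem II_zero (n : ℕ) : ∀ (S : Finset (Fin N)) (x : Fin N → ℤ),
    II n S x (fun _ => 0) = 0 := by
  induction n with
  | zero => intros; rfl
  | succ n ih =>
    intro S x
    simp only [II, ih, Finset.sum_const_zero]

theorem sum_swap (S : Finset (Fin N)) (G : Fin N → Fin N → ZMod 2) :
    ∑ i ∈ S, ∑ j ∈ S.erase i, G i j = ∑ j ∈ S, ∑ i ∈ S.erase j, G i j := by
  refine Finset.sum_comm' ?_
  intro i j
  simp only [Finset.mem_erase, ne_eq]
  tauto

theorem sum_symm_zero (S : Finset (Fin N)) (G : Fin N → Fin N → ZMod 2)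
    (h : ∀ i j, G i j = G j i) :
    ∑ i ∈ S, ∑ j ∈ S.erase i, G i j = 0 := by
  rw [Finset.sum_sigma']
  refine Finset.sum_involution (fun a _ => ⟨a.2, a.1⟩) ?_ ?_ ?_ ?_
  · intro a _
    rw [h a.1 a.2]; exact two_mul_zero _
  · rintro ⟨a, b⟩ ha _ heq
    simp only [Finset.mem_sigma, Finset.mem_erase] at ha
    simp only [Sigma.mk.injEq] at heq
    exact ha.2.1 heq.1
  · rintro ⟨a, b⟩ ha
    simp only [Finset.mem_sigma, Finset.mem_erase] at ha ⊢
    exact ⟨ha.2.2, Ne.symm ha.2.1, ha.1⟩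
  · rintro ⟨a, b⟩ _; rfl

/-- coboundary -/
def dd {V : Type*} (φ : List V → ZMod 2) : List V → ZMod 2 := fun l => wd (fun _ => 1) l φ

theorem dd_dd {V : Type*} (φ : List V → ZMod 2) : dd (dd φ) = fun _ => 0 := by
  funext l; exact wd_self _ _ _

theorem stokes (n : ℕ) : ∀ (S : Finset (Fin N)) (x : Fin N → ℤ)
    (φ : List (Fin N → ℤ) → ZMod 2), S.card = n + 1 →
    II (n + 1) S x (dd φ) = ∑ i ∈ S, (II n (S.erase i) (x + st i) φ + II n (S.erase i) x φ) := by
  induction n with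
  | zero => intro S x φ _; simp [II, dd, wd]
  | succ n ih =>
    intro S x φ hS
    have h1 : II (n + 2) S x (dd φ) = ∑ i ∈ S, (II (n + 1) (S.erase i) (x + st i) φ +
        II (n + 1) (S.erase i) (x + st i) (dd fun t => φ (x :: t))) := by
      conv_lhs => rw [II]
      refine Finset.sum_congr rfl fun i hi => ?_
      rw [← II_add]
      simp [dd, wd]
    rw [h1, Finset.sum_add_distrib, Finset.sum_add_distrib]
    congr 1
    have h2 : ∀ i ∈ S, II (n + 1) (S.erase i) (x + st i) (dd fun t => φ (x :: t)) =
        ∑ j ∈ S.erase i, II n ((S.erase i).erase j) (x + st i + st j) (fun t => φ (x :: t)) +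
        ∑ j ∈ S.erase i, II n ((S.erase i).erase j) (x + st i) (fun t => φ (x :: t)) := by
      intro i hi
      rw [ih _ _ _ (by rw [Finset.card_erase_of_mem hi]; omega), Finset.sum_add_distrib]
    rw [Finset.sum_congr rfl h2, Finset.sum_add_distrib, sum_symm_zero, zero_add, sum_swap]
    · refine Finset.sum_congr rfl fun j hj => ?_
      conv_rhs => rw [II]
      refine Finset.sum_congr rfl fun i hi => ?_
      rw [Finset.erase_right_comm]
    · intro i j
      rw [Finset.erase_right_comm, add_right_comm]

theorem II_last (n : ℕ) : ∀ (S : Finset (Fin N)) (x : Fin N → ℤ)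
    (φ : List (Fin N → ℤ) → ZMod 2), S.card = n + 1 →
    (∀ s t : List (Fin N → ℤ), s.Perm t → φ s = φ t) →
    II (n + 1) S x φ = ∑ i ∈ S, II n (S.erase i) x (fun t => φ ((x + ind S) :: t)) := by
  induction n with
  | zero =>
    intro S x φ hS hφ
    simp only [II]
    refine Finset.sum_congr rfl fun i hi => ?_
    rw [hφ _ _ (List.Perm.swap _ _ _)]
    obtain ⟨a, rfl⟩ := Finset.card_eq_one.1 hS
    rw [Finset.mem_singleton] at hi
    subst hi
    rw [ind_erase {i} i (by simp)]
    have : ind (({i} : Finset (Fin N)).erase i) = 0 := by funext j; simp [ind]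
    rw [this, zero_add]
  | succ n ih =>
    intro S x φ hS hφ
    rw [II]
    have h1 : ∀ i ∈ S, II (n + 1) (S.erase i) (x + st i) (fun t => φ (x :: t)) =
        ∑ j ∈ S.erase i, II n ((S.erase i).erase j) (x + st i)
          (fun t => φ (x :: (x + ind S) :: t)) := by
      intro i hi
      rw [ih _ _ _ (by rw [Finset.card_erase_of_mem hi]; omega)
        (fun s t hst => hφ _ _ (hst.cons _))]
      have : x + st i + ind (S.erase i) = x + ind S := by
        rw [ind_erase S i hi]; abel
      rw [this]
    rw [Finset.sum_congr rfl h1, sum_swap]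
    refine Finset.sum_congr rfl fun j hj => ?_
    conv_rhs => rw [II]
    refine Finset.sum_congr rfl fun i hi => ?_
    rw [Finset.erase_right_comm]
    congr 1
    funext t
    exact hφ _ _ (List.Perm.swap _ _ _)

theorem II_neg (n : ℕ) : ∀ (S : Finset (Fin N)) (x : Fin N → ℤ)
    (φ : List (Fin N → ℤ) → ZMod 2), S.card = n →
    (∀ s t : List (Fin N → ℤ), s.Perm t → φ s = φ t) →
    II n S (-x - ind S) φ = II n S x (fun l => φ (l.map (fun v => -v))) := by
  induction n with
  | zero =>
    intro S x φ hS hφ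
    rw [Finset.card_eq_zero] at hS
    subst hS
    have : ind (∅ : Finset (Fin N)) = 0 := by funext j; simp [ind]
    simp [II, this]
  | succ n ih =>
    intro S x φ hS hφ
    rw [II_last n S x _ hS (fun s t hst => hφ _ _ (hst.map _)), II]
    refine Finset.sum_congr rfl fun i hi => ?_
    have : -x - ind S + st i = -x - ind (S.erase i) := by
      rw [ind_erase S i hi]; abel
    rw [this, ih _ _ _ (by rw [Finset.card_erase_of_mem hi]; omega)
      (fun s t hst => hφ _ _ (hst.cons _))]
    congr 1
    funext t
    simp only [List.map_cons]
    congr 2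
    abel

end

section
variable {N : ℕ}

def sk (N k : ℕ) : Finset (Fin N) := Finset.univ.filter (fun i => i.val < k)

theorem sk_card (k : ℕ) (hk : k ≤ N) : (sk N k).card = k := by
  rw [sk, Fin.card_filter_val_lt]; omega

theorem sk_erase (k : ℕ) (hk : k < N) : (sk N (k + 1)).erase ⟨k, hk⟩ = sk N k := by
  ext i
  simp only [sk, Finset.mem_erase, Finset.mem_filter, Finset.mem_univ, true_and, ne_eq, Fin.ext_iff]
  omega

theorem sum_eq_of_vanish {α : Type*} [DecidableEq α] (A B : Finset α) (g : α → ZMod 2)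
    (h1 : ∀ x ∈ A, x ∉ B → g x = 0) (h2 : ∀ x ∈ B, x ∉ A → g x = 0) :
    ∑ x ∈ A, g x = ∑ x ∈ B, g x := by
  rw [Finset.sum_subset (Finset.subset_union_left (s₁ := A) (s₂ := B)),
    Finset.sum_subset (Finset.subset_union_right (s₁ := A) (s₂ := B))]
  · intro x hx hx'
    rw [Finset.mem_union] at hx
    exact h1 x (by tauto) hx'
  · intro x hx hx'
    rw [Finset.mem_union] at hx
    exact h2 x (by tauto) hx'

def inCube (x : Fin N → ℤ) (S : Finset (Fin N)) (l : List (Fin N → ℤ)) : Prop :=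
  ∀ v ∈ l, ∀ i, x i ≤ v i ∧ v i ≤ x i + ind S i

structure Region (N : ℕ) (X : ℕ → Finset (Fin N → ℤ)) (near : List (Fin N → ℤ) → Prop) : Prop where
  flat : ∀ k, ∀ x ∈ X k, ∀ i : Fin N, k ≤ i.val → x i = 0
  symm : ∀ k x, x ∈ X k → -x - ind (sk N k) ∈ X k
  zero : X 0 = {0}
  cross : ∀ k < N, ∀ i ∈ sk N (k + 1), ∀ x l, ¬ (x ∈ X (k + 1) ↔ x - st i ∈ X (k + 1)) →
    inCube x ((sk N (k + 1)).erase i) l → near l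
  cross' : ∀ k, ∀ hk : k < N, ∀ x l, x ⟨k, hk⟩ = 0 → ¬ (x ∈ X (k + 1) ↔ x ∈ X k) →
    inCube x (sk N k) l → near l

def Xp (X : ℕ → Finset (Fin N → ℤ)) (k : ℕ) (hk : k < N) : Finset (Fin N → ℤ) :=
  (X (k + 1)).filter (fun x => 0 ≤ x ⟨k, hk⟩)

theorem local_bd {X : ℕ → Finset (Fin N → ℤ)} {near : List (Fin N → ℤ) → Prop}
    (R : Region N X near) (k : ℕ) (hk : k < N) (φ : List (Fin N → ℤ) → ZMod 2)
    (hφ : ∀ l, near l → l.length = k + 1 → φ l = 0) :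
    ∑ x ∈ Xp X k hk, II (k + 1) (sk N (k + 1)) x (dd φ) = ∑ x ∈ X k, II k (sk N k) x φ := by
  have hv : ∀ S x, (∀ l, inCube x S l → near l) → II k S x φ = 0 := by
    intro S x h
    rw [II_congr k S x φ (fun _ => 0), II_zero]
    intro l hl hc
    exact hφ l (h l hc) hl
  rw [Finset.sum_congr rfl fun x _ => stokes k (sk N (k + 1)) x φ (sk_card _ (by omega)),
    Finset.sum_comm]
  have hshift : ∀ (i : Fin N) (g : (Fin N → ℤ) → ZMod 2), ∑ x ∈ Xp X k hk, g (x + st i) =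
      ∑ y ∈ (Xp X k hk).map (addRightEmbedding (st i)), g y := by
    intro i g; rw [Finset.sum_map]; rfl
  have hmem : ∀ (i : Fin N) y, y ∈ (Xp X k hk).map (addRightEmbedding (st i)) ↔
      y - st i ∈ X (k + 1) ∧ 0 ≤ (y - st i) ⟨k, hk⟩ := by
    intro i y
    rw [Finset.mem_map]
    constructor
    · rintro ⟨x, hx, rfl⟩
      simpa [Xp] using hx
    · intro h
      exact ⟨y - st i, by rw [Xp, Finset.mem_filter]; exact h, by simp⟩
  rw [Finset.sum_eq_single (⟨k, hk⟩ : Fin N)]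
  · rw [Finset.sum_add_distrib, hshift ⟨k, hk⟩ (fun y => II k ((sk N (k + 1)).erase ⟨k, hk⟩) y φ),
      sk_erase k hk]
    have hdisj : Disjoint ((Xp X k hk).map (addRightEmbedding (st ⟨k, hk⟩))) (X k) := by
      rw [Finset.disjoint_left]
      intro y hy hy'
      rw [hmem] at hy
      have h1 := R.flat k y hy' ⟨k, hk⟩ le_rfl
      have h2 := hy.2
      simp [h1] at h2
    have hX : ∑ x ∈ Xp X k hk, II k (sk N k) x φ =
        ∑ y ∈ ((Xp X k hk).map (addRightEmbedding (st ⟨k, hk⟩))).disjUnion (X k) hdisj,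
          II k (sk N k) y φ := by
      have hc := R.cross k hk ⟨k, hk⟩ (by simp [sk])
      rw [sk_erase k hk] at hc
      apply sum_eq_of_vanish
      · intro y hy hy'
        rw [Finset.mem_disjUnion, hmem, not_or] at hy'
        rw [Xp, Finset.mem_filter] at hy
        apply hv
        intro l hl
        by_cases h0 : y ⟨k, hk⟩ = 0
        · exact R.cross' k hk y l h0 (by tauto) hl
        · refine hc y l ?_ hl
          intro h
          refine hy'.1 ⟨h.1 hy.1, ?_⟩
          have := hy.2
          simp
          omega
      · intro y hy hy'
        rw [Finset.mem_disjUnion, hmem] at hy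
        rw [Xp, Finset.mem_filter] at hy'
        apply hv
        intro l hl
        rcases hy with hy | hy
        · refine hc y l ?_ hl
          intro h
          refine hy' ⟨h.2 hy.1, ?_⟩
          have := hy.2
          simp at this
          omega
        · have h0 := R.flat k y hy ⟨k, hk⟩ le_rfl
          refine R.cross' k hk y l h0 ?_ hl
          intro h
          exact hy' ⟨h.2 hy, h0.ge⟩
    rw [hX, Finset.sum_disjUnion, ← add_assoc, two_mul_zero, zero_add]
  · intro i hi hik
    rw [Finset.sum_add_distrib, hshift i (fun y => II k ((sk N (k + 1)).erase i) y φ)]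
    have : ∑ x ∈ Xp X k hk, II k ((sk N (k + 1)).erase i) x φ =
        ∑ y ∈ (Xp X k hk).map (addRightEmbedding (st i)), II k ((sk N (k + 1)).erase i) y φ := by
      have hs : ∀ y : Fin N → ℤ, (y - st i) ⟨k, hk⟩ = y ⟨k, hk⟩ := by
        intro y; simp [hik]
      apply sum_eq_of_vanish
      · intro y hy hy'
        rw [hmem, hs] at hy'
        rw [Xp, Finset.mem_filter] at hy
        exact hv _ _ fun l hl => R.cross k hk i hi y l (by tauto) hl
      · intro y hy hy'
        rw [hmem, hs] at hy
        rw [Xp, Finset.mem_filter] at hy'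
        exact hv _ _ fun l hl => R.cross k hk i hi y l (by tauto) hl
    rw [this, two_mul_zero]
  · intro h; exact absurd (by simp [sk]) h

theorem half_sum {X : ℕ → Finset (Fin N → ℤ)} {near : List (Fin N → ℤ) → Prop}
    (R : Region N X near) (k : ℕ) (hk : k < N) (φ : List (Fin N → ℤ) → ZMod 2)
    (hφ : ∀ s t : List (Fin N → ℤ), s.Perm t → φ s = φ t) :
    ∑ x ∈ X (k + 1), II (k + 1) (sk N (k + 1)) x φ =
    ∑ x ∈ Xp X k hk, II (k + 1) (sk N (k + 1)) x
      (fun l => φ l + φ (l.map (fun v => -v))) := by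
  rw [← Finset.sum_filter_add_sum_filter_not (X (k + 1)) (fun x => 0 ≤ x ⟨k, hk⟩)]
  simp only [II_add]
  rw [Finset.sum_add_distrib]
  congr 1
  have hk1 : ind (sk N (k + 1)) ⟨k, hk⟩ = 1 := by simp [ind, sk]
  symm
  refine Finset.sum_nbij' (fun x => -x - ind (sk N (k + 1))) (fun x => -x - ind (sk N (k + 1)))
    ?_ ?_ ?_ ?_ ?_
  · intro x hx
    rw [Xp, Finset.mem_filter] at hx
    rw [Finset.mem_filter]
    refine ⟨R.symm _ _ hx.1, ?_⟩
    have := hx.2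
    simp [hk1]; omega
  · intro x hx
    rw [Finset.mem_filter] at hx
    rw [Xp, Finset.mem_filter]
    refine ⟨R.symm _ _ hx.1, ?_⟩
    have := hx.2
    simp [hk1]; omega
  · intro x _; simp
  · intro x _; simp
  · intro x _
    rw [II_neg _ _ _ _ (sk_card _ (by omega)) hφ]

theorem dd_perm {V : Type*} (φ : List V → ZMod 2)
    (hφ : ∀ s t : List V, s.Perm t → φ s = φ t) (s t : List V) (h : s.Perm t) :
    dd φ s = dd φ t := wd_perm _ h _ hφ

theorem combinatorial {X : ℕ → Finset (Fin N → ℤ)} {near : List (Fin N → ℤ) → Prop}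
    (R : Region N X near) (m : ℕ) (hm : m < N) (p q : ℕ → (Fin N → ℤ) → ZMod 2)
    (hpq : ∀ j v, p j (-v) = q j v)
    (hn1 : ∀ l, near l → ∀ j < m, ∀ a ∈ l, ∀ b ∈ l, p j a * q j b = 0)
    (hn2 : ∀ l, near l → ∀ a ∈ l, uu p q m a = 1) : False := by
  have hqp : ∀ j v, q j (-v) = p j v := by intro j v; rw [← hpq, neg_neg]
  set W := WW p q m with hW
  set Y : List (Fin N → ℤ) → ZMod 2 := fun l => W l + W (l.map (fun v => -v)) with hY
  have hYW : ∀ l, Y l = WW p q m l + WW q p m l := by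
    intro l; simp only [hY, hW]
    rw [WW_map (fun v => -v) p q hpq hqp]
  have hWp : ∀ s t : List (Fin N → ℤ), s.Perm t → W s = W t := WW_perm p q m
  have hYp : ∀ s t : List (Fin N → ℤ), s.Perm t → Y s = Y t := by
    intro s t h; simp only [hY]; rw [hWp s t h, hWp _ _ (h.map _)]
  have hYs : ∀ l, Y l + Y (l.map (fun v => -v)) = 0 := by
    intro l
    simp only [hY, List.map_map]
    have : ((fun v : Fin N → ℤ => -v) ∘ fun v => -v) = id := by funext v; simp
    rw [this, List.map_id, add_comm (W (l.map _)) (W l), two_mul_zero]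
  -- D_k(Y) = 0
  have hDY : ∀ k ≤ N, ∑ x ∈ X k, II k (sk N k) x Y = 0 := by
    intro k hk
    cases k with
    | zero =>
      rw [R.zero, Finset.sum_singleton]
      simp only [II, hY]
      simpa using two_mul_zero (W [0])
    | succ k =>
      rw [half_sum R k (by omega) Y hYp]
      refine Finset.sum_eq_zero fun x _ => ?_
      simp only [hYs]
      exact II_zero _ _ _
  have hddY : ∀ l, dd Y l = dd W l + dd W (l.map (fun v => -v)) := by
    intro l
    simp only [dd, hY]
    rw [wd_add, wd_map]
  have hadd : ∀ (φ ψ : List (Fin N → ℤ) → ZMod 2) l,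
      dd (fun t => φ t + ψ t) l = dd φ l + dd ψ l := fun φ ψ l => wd_add _ _ _ _
  have claim : ∀ k, ∀ hk : k < N,
      ∑ x ∈ Xp X k hk, II (k + 1) (sk N (k + 1)) x (dd Y) = 1 := by
    intro k
    induction k with
    | zero =>
      intro hk
      have h := local_bd R 0 hk (fun l => Y l + 1) (by
        intro l hl hlen
        obtain ⟨a, rfl⟩ := List.length_eq_one_iff.1 hlen
        rw [hYW, WW_single p q m a (fun j hj => hn1 _ hl j hj a (by simp) a (by simp))
          (hn2 _ hl a (by simp))]
        exact two_mul_zero 1)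
      have e1 : ∀ x, II (0 + 1) (sk N (0 + 1)) x (dd fun l => Y l + 1) =
          II (0 + 1) (sk N (0 + 1)) x (dd Y) := by
        intro x
        refine II_congr _ _ _ _ _ fun l hl _ => ?_
        obtain ⟨a, b, rfl⟩ := List.length_eq_two.1 hl
        rw [hadd]
        have : dd (fun _ : List (Fin N → ℤ) => (1 : ZMod 2)) [a, b] = 0 := by
          simp [dd, wd]; exact two_mul_zero 1
        rw [this, add_zero]
      rw [Finset.sum_congr rfl fun x _ => e1 x] at h
      rw [h]
      simp only [II_add, Finset.sum_add_distrib]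
      rw [hDY 0 (by omega), R.zero]
      simp [II]
    | succ k ih =>
      intro hk
      have h := local_bd R (k + 1) hk (fun l => Y l + dd W l) (by
        intro l hl hlen
        rw [hYW]
        have := WW_main p q m l (hn1 l hl) (hn2 l hl) (by omega)
        simp only [dd]
        rw [hW, this]
        exact two_mul_zero _)
      have e1 : (dd fun l => Y l + dd W l) = dd Y := by
        funext l
        rw [hadd, dd_dd, add_zero]
      rw [e1] at h
      rw [h]
      simp only [II_add, Finset.sum_add_distrib]
      rw [hDY (k + 1) (by omega), zero_add, half_sum R k (by omega) _ (dd_perm W hWp)]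
      simp only [← hddY]
      exact ih (by omega)
  have hfin := claim (N - 1) (by omega)
  rw [Finset.sum_eq_zero] at hfin
  · exact zero_ne_one hfin
  · intro x _
    rw [II_congr _ _ _ _ (fun _ => 0), II_zero]
    intro l hl _
    simp only [dd]
    rw [wd_congr_len _ l _ (fun _ => 0), wd_zero]
    intro t ht
    rw [hYW, WW_len, WW_len, add_zero] <;> omega

end

section
open Set
variable {N : ℕ}

theorem exists_frontier {E : Type*} [NormedAddCommGroup E] [NormedSpace ℝ E] {Ω : Set E}
    (ho : IsOpen Ω) {a b : E} (ha : a ∈ Ω) (hb : b ∉ Ω) :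
    ∃ z ∈ segment ℝ a b, z ∈ frontier Ω := by
  by_contra hcon
  push Not at hcon
  have hfr : frontier Ω = closure Ω \ Ω := ho.frontier_eq
  have hpre := (convex_segment (𝕜 := ℝ) a b).isPreconnected
  obtain ⟨z, _, hz1, hz2⟩ := hpre Ω (closure Ω)ᶜ ho isClosed_closure.isOpen_compl (by
      intro z hz
      by_cases h : z ∈ Ω
      · exact Or.inl h
      · right
        intro hc
        exact hcon z hz (by rw [hfr]; exact ⟨hc, h⟩))
    ⟨a, left_mem_segment ℝ a b, ha⟩
    ⟨b, right_mem_segment ℝ a b, fun hc =>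
      hcon b (right_mem_segment ℝ a b) (by rw [hfr]; exact ⟨hc, hb⟩)⟩
  exact hz2 (subset_closure hz1)

noncomputable def ctr (h : ℝ) (k : ℕ) (x : Fin N → ℤ) : Fin N → ℝ :=
  fun i => h * (x i + ind (sk N k) i / 2)

noncomputable def emb (h : ℝ) (x : Fin N → ℤ) : Fin N → ℝ := fun i => h * x i

theorem ind_bd (S : Finset (Fin N)) (i : Fin N) : (0 : ℝ) ≤ ind S i ∧ (ind S i : ℝ) ≤ 1 := by
  simp only [ind]; split_ifs <;> simp

theorem near_of {Ω : Set (Fin N → ℝ)} (ho : IsOpen Ω) (ε h : ℝ) (hh : 0 < h) (hε : 2 * h < ε)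
    (x : Fin N → ℤ) (S : Finset (Fin N)) (a b : Fin N → ℝ)
    (ha : ∀ i, h * (x i - 1) ≤ a i ∧ a i ≤ h * (x i + 1))
    (hb : ∀ i, h * (x i - 1) ≤ b i ∧ b i ≤ h * (x i + 1))
    (hab : ¬ (a ∈ Ω ↔ b ∈ Ω)) (l : List (Fin N → ℤ)) (hl : inCube x S l) :
    ∃ y ∈ frontier Ω, ∀ v ∈ l, dist y (emb h v) < ε := by
  have : ∃ z ∈ segment ℝ a b, z ∈ frontier Ω := by
    by_cases h1 : a ∈ Ω
    · exact exists_frontier ho h1 (by tauto)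
    · rw [segment_symm]
      exact exists_frontier ho (by tauto) h1
  obtain ⟨z, hz, hzf⟩ := this
  refine ⟨z, hzf, fun v hv => ?_⟩
  have hzI : z ∈ Icc (fun i => h * ((x i : ℝ) - 1)) (fun i => h * ((x i : ℝ) + 1)) :=
    (convex_Icc (𝕜 := ℝ) _ _).segment_subset
      ⟨fun i => (ha i).1, fun i => (ha i).2⟩ ⟨fun i => (hb i).1, fun i => (hb i).2⟩ hz
  refine lt_of_le_of_lt ((dist_pi_le_iff (by linarith)).2 fun i => ?_) hε
  have h1 : h * ((x i : ℝ) - 1) ≤ z i := hzI.1 i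
  have h2 : z i ≤ h * ((x i : ℝ) + 1) := hzI.2 i
  obtain ⟨h3, h4⟩ := hl v hv i
  have h3' : (x i : ℝ) ≤ v i := by exact_mod_cast h3
  have h4' : (v i : ℝ) ≤ x i + ind S i := by exact_mod_cast h4
  have h5 := (ind_bd S i).2
  rw [Real.dist_eq, abs_le]
  simp only [emb]
  have h6 : h * (x i : ℝ) ≤ h * v i := mul_le_mul_of_nonneg_left h3' hh.le
  have h7 : h * (v i : ℝ) ≤ h * (x i + 1) := mul_le_mul_of_nonneg_left (by linarith) hh.le
  constructor <;> linarith

theorem region_exists {Ω : Set (Fin N → ℝ)} (ho : IsOpen Ω) (hb : Bornology.IsBounded Ω)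
    (hs : ∀ x ∈ Ω, -x ∈ Ω) (h0 : (0 : Fin N → ℝ) ∈ Ω) (ε : ℝ) (hε : 0 < ε) :
    ∃ (h : ℝ) (X : ℕ → Finset (Fin N → ℤ)),
      Region N X (fun l => ∃ y ∈ frontier Ω, ∀ v ∈ l, dist y (emb h v) < ε) := by
  obtain ⟨h, hh, hhε⟩ : ∃ h : ℝ, 0 < h ∧ 2 * h < ε := ⟨ε / 3, by linarith, by linarith⟩
  have hfin : ∀ k, {x : Fin N → ℤ | (∀ i : Fin N, k ≤ i.val → x i = 0) ∧ ctr h k x ∈ Ω}.Finite := by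
    intro k
    obtain ⟨R, hR⟩ := hb.exists_norm_le
    refine (Set.finite_Icc (fun _ : Fin N => -(⌈R / h⌉ + 1)) (fun _ => ⌈R / h⌉ + 1)).subset ?_
    rintro x ⟨_, hx⟩
    have h1 : ∀ i, |h * ((x i : ℝ) + ind (sk N k) i / 2)| ≤ R := by
      intro i
      exact (norm_le_pi_norm (ctr h k x) i).trans (hR _ hx)
    have h2 : ∀ i, -(R / h) ≤ (x i : ℝ) + ind (sk N k) i / 2 ∧
        (x i : ℝ) + ind (sk N k) i / 2 ≤ R / h := by
      intro i
      have := h1 i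
      rw [abs_mul, abs_of_pos hh, mul_comm, ← le_div_iff₀ hh] at this
      exact abs_le.1 this
    have hc := Int.le_ceil (R / h)
    constructor <;> intro i
    · have := (h2 i).1
      have hi := (ind_bd (sk N k) i)
      have : ((-(⌈R / h⌉ + 1) : ℤ) : ℝ) ≤ x i := by push_cast; linarith [hi.2]
      exact_mod_cast this
    · have := (h2 i).2
      have hi := (ind_bd (sk N k) i)
      have : (x i : ℝ) ≤ ((⌈R / h⌉ + 1 : ℤ) : ℝ) := by push_cast; linarith [hi.1]
      exact_mod_cast this
  have hctr : ∀ k (x : Fin N → ℤ) i, h * (x i - 1) ≤ ctr h k x i ∧ ctr h k x i ≤ h * (x i + 1) := by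
    intro k x i
    have hi := (ind_bd (sk N k) i)
    exact ⟨mul_le_mul_of_nonneg_left (by linarith [hi.1]) hh.le,
      mul_le_mul_of_nonneg_left (by linarith [hi.2]) hh.le⟩
  refine ⟨h, fun k => (hfin k).toFinset, ?_, ?_, ?_, ?_, ?_⟩
  · intro k x hx
    rw [Set.Finite.mem_toFinset] at hx
    exact hx.1
  · intro k x hx
    rw [Set.Finite.mem_toFinset] at hx ⊢
    refine ⟨fun i hi => ?_, ?_⟩
    · have : i ∉ sk N k := by simp [sk]; exact hi
      simp [hx.1 i hi, ind, this]
    · have := hs _ hx.2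
      convert this using 1
      funext i
      simp only [ctr, Pi.neg_apply, Pi.sub_apply]
      push_cast
      ring
  · ext x
    rw [Set.Finite.mem_toFinset, Finset.mem_singleton]
    constructor
    · intro hx
      funext i
      exact hx.1 i (Nat.zero_le _)
    · rintro rfl
      refine ⟨fun i _ => rfl, ?_⟩
      convert h0 using 1
      funext i
      simp [ctr, ind, sk]
  · intro k hk i hi x l hne hl
    refine near_of ho ε h hh hhε x _ (ctr h (k+1) x) (ctr h (k+1) (x - st i)) (hctr _ x) ?_ ?_ l hl
    · intro j
      have hj := (ind_bd (sk N (k+1)) j)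
      have hst : (0 : ℝ) ≤ ((st i : Fin N → ℤ) j : ℝ) ∧ ((st i : Fin N → ℤ) j : ℝ) ≤ 1 := by
        simp only [Pi.single_apply]; split_ifs <;> simp
      simp only [ctr, Pi.sub_apply, Int.cast_sub]
      exact ⟨mul_le_mul_of_nonneg_left (by linarith [hj.1, hst.2]) hh.le,
        mul_le_mul_of_nonneg_left (by linarith [hj.2, hst.1]) hh.le⟩
    · rw [Set.Finite.mem_toFinset, Set.Finite.mem_toFinset] at hne
      intro hiff
      apply hne
      have hfl : (∀ j : Fin N, k + 1 ≤ j.val → x j = 0) ↔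
          (∀ j : Fin N, k + 1 ≤ j.val → (x - st i) j = 0) := by
        refine forall_congr' fun j => forall_congr' fun hj => ?_
        have : j ≠ i := by
          rintro rfl
          simp [sk] at hi
          omega
        simp [this]
      exact and_congr hfl hiff
  · intro k hk x l hx0 hne hl
    refine near_of ho ε h hh hhε x _ (ctr h (k+1) x) (ctr h k x) (hctr _ x) (hctr _ x) ?_ l hl
    rw [Set.Finite.mem_toFinset, Set.Finite.mem_toFinset] at hne
    intro hiff
    apply hne
    have hfl : (∀ j : Fin N, k + 1 ≤ j.val → x j = 0) ↔ (∀ j : Fin N, k ≤ j.val → x j = 0) := by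
      constructor
      · intro hh j hj
        by_cases hjk : j.val = k
        · have : j = ⟨k, hk⟩ := Fin.ext hjk
          rw [this]; exact hx0
        · exact hh j (by omega)
      · intro hh j hj
        exact hh j (by omega)
    exact and_congr hfl hiff

open Classical in
noncomputable def lab (δ : ℝ) (g : ℕ → ℝ) (j : ℕ) : ZMod 2 :=
  if δ ≤ g j ∧ ∀ i < j, |g i| < δ then 1 else 0

open Classical in
theorem uu_lab {V : Type*} (δ : ℝ) (hδ : 0 < δ) (g : V → ℕ → ℝ) (v : V) (m : ℕ) :
    uu (fun j v => lab δ (g v) j) (fun j v => lab δ (fun i => - g v i) j) m v =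
    if ∃ j < m, δ ≤ |g v j| then 1 else 0 := by
  induction m with
  | zero => simp [uu]
  | succ m ih =>
    simp only [uu, ih]
    by_cases h : ∃ j < m, δ ≤ |g v j|
    · have h' : ∃ j < m + 1, δ ≤ |g v j| := by
        obtain ⟨j, hj, h⟩ := h; exact ⟨j, by omega, h⟩
      rw [if_pos h, if_pos h']
      obtain ⟨j, hj, h⟩ := h
      have a1 : lab δ (g v) m = 0 := by
        rw [lab, if_neg]; rintro ⟨_, h2⟩; linarith [h2 j hj]
      have a2 : lab δ (fun i => - g v i) m = 0 := by
        rw [lab, if_neg]; rintro ⟨_, h2⟩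
        have := h2 j hj
        rw [abs_neg] at this
        linarith
      rw [a1, a2]; simp
    · rw [if_neg h]
      push Not at h
      by_cases h1 : δ ≤ g v m
      · have a1 : lab δ (g v) m = 1 := by rw [lab, if_pos ⟨h1, h⟩]
        have a2 : lab δ (fun i => - g v i) m = 0 := by
          rw [lab, if_neg]; rintro ⟨h2, _⟩; linarith
        rw [a1, a2, if_pos ⟨m, by omega, h1.trans (le_abs_self _)⟩]; simp
      · have a1 : lab δ (g v) m = 0 := by rw [lab, if_neg]; rintro ⟨h2, _⟩; exact h1 h2
        by_cases h2 : δ ≤ - g v m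
        · have a2 : lab δ (fun i => - g v i) m = 1 := by
            rw [lab, if_pos]; exact ⟨h2, fun i hi => by rw [abs_neg]; exact h i hi⟩
          rw [a1, a2, if_pos ⟨m, by omega, h2.trans (neg_le_abs _)⟩]; simp
        · have a2 : lab δ (fun i => - g v i) m = 0 := by
            rw [lab, if_neg]; rintro ⟨h3, _⟩; exact h2 h3
          rw [a1, a2, if_neg]
          · simp
          · rintro ⟨j, hj, hj'⟩
            by_cases hjm : j = m
            · subst hjm
              rcases le_abs'.1 hj' with h3 | h3
              · exact h2 (by linarith)
              · exact h1 h3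
            · linarith [h j (by omega)]

theorem no_odd {Ω : Set (Fin N → ℝ)} (ho : IsOpen Ω) (hb : Bornology.IsBounded Ω)
    (hs : ∀ x ∈ Ω, -x ∈ Ω) (h0 : (0 : Fin N → ℝ) ∈ Ω) (m : ℕ) (hm : m < N)
    (F : (Fin N → ℝ) → (Fin m → ℝ)) (hF : Continuous F) (hodd : ∀ x, F (-x) = - F x)
    (hne : ∀ x ∈ frontier Ω, F x ≠ 0) : False := by
  have hcomp : IsCompact (frontier Ω) :=
    Metric.isCompact_of_isClosed_isBounded isClosed_frontier (hb.closure.subset frontier_subset_closure)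
  obtain ⟨c, hc, hcF⟩ := hcomp.exists_forall_le' (f := fun x => ‖F x‖) (a := 0)
    hF.norm.continuousOn (fun x hx => norm_pos_iff.2 (hne x hx))
  set δ := c / 2 with hδdef
  have hδ : 0 < δ := by positivity
  obtain ⟨ε, hε, hεF⟩ := Metric.mem_uniformity_dist.1
    (hcomp.uniformContinuousAt_of_continuousAt F (fun a _ => hF.continuousAt)
      (Metric.dist_mem_uniformity hδ))
  obtain ⟨h, X, R⟩ := region_exists ho hb hs h0 ε hε
  let g : (Fin N → ℤ) → ℕ → ℝ := fun v j => if hj : j < m then F (emb h v) ⟨j, hj⟩ else 0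
  have hclose : ∀ y ∈ frontier Ω, ∀ v, dist y (emb h v) < ε → ∀ j, ∀ hj : j < m,
      |F y ⟨j, hj⟩ - g v j| < δ := by
    intro y hy v hv j hj
    have h1 : dist (F y) (F (emb h v)) < δ := hεF hv hy
    have h2 := (dist_le_pi_dist (F y) (F (emb h v)) ⟨j, hj⟩).trans_lt h1
    simpa [g, hj, Real.dist_eq] using h2
  have hgneg : ∀ v, g (-v) = fun i => - g v i := by
    intro v
    funext j
    have : emb h (-v) = - emb h v := by funext i; simp [emb]
    simp only [g, this, hodd]
    split_ifs <;> simp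
  refine combinatorial R m hm (fun j v => lab δ (g v) j) (fun j v => lab δ (fun i => - g v i) j)
    ?_ ?_ ?_
  · intro j v
    simp only [hgneg]
  · rintro l ⟨y, hy, hl⟩ j hj a ha b hb
    have h1 := abs_lt.1 (hclose y hy a (hl a ha) j hj)
    have h2 := abs_lt.1 (hclose y hy b (hl b hb) j hj)
    by_cases h3 : δ ≤ g a j
    · have : ¬ (δ ≤ - g b j) := by intro h4; linarith [h1.1, h2.2]
      simp [lab, this]
    · simp [lab, h3]
  · rintro l ⟨y, hy, hl⟩ a ha
    rw [uu_lab δ hδ, if_pos]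
    by_contra hcon
    push Not at hcon
    have : ‖F y‖ < c := by
      rw [pi_norm_lt_iff hc]
      rintro ⟨j, hj⟩
      have h1 := hclose y hy a (hl a ha) j hj
      have h2 := hcon j hj
      rw [Real.norm_eq_abs]
      have h3 := abs_add_le (F y ⟨j, hj⟩ - g a j) (g a j)
      rw [sub_add_cancel] at h3
      linarith
    linarith [hcF y hy]

theorem no_odd_euclid (Ω : Set (EuclideanSpace ℝ (Fin N)))
    (ho : IsOpen Ω) (hb : Bornology.IsBounded Ω)
    (hs : ∀ x ∈ Ω, -x ∈ Ω) (h0 : (0 : EuclideanSpace ℝ (Fin N)) ∈ Ω) (m : ℕ) (hm : m < N)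
    (f : EuclideanSpace ℝ (Fin N) → EuclideanSpace ℝ (Fin m)) (hf : ContinuousOn f (frontier Ω))
    (hodd : ∀ x ∈ frontier Ω, f (-x) = - f x) (hne : ∀ x ∈ frontier Ω, f x ≠ 0) : False := by
  let e := EuclideanSpace.equiv (Fin N) ℝ
  let e' := EuclideanSpace.equiv (Fin m) ℝ
  have hfc : Continuous (fun x : frontier Ω => e' (f x)) :=
    e'.continuous.comp (continuousOn_iff_continuous_domRestrict.1 hf)
  obtain ⟨G, hG⟩ := ContinuousMap.exists_restrict_eq (isClosed_frontier (s := Ω)) ⟨_, hfc⟩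
  have hG' : ∀ x ∈ frontier Ω, G x = e' (f x) := fun x hx => DFunLike.congr_fun hG ⟨x, hx⟩
  have hfs : ∀ x ∈ frontier Ω, -x ∈ frontier Ω := by
    intro x hx
    have h1 : (Homeomorph.neg (EuclideanSpace ℝ (Fin N))) ⁻¹' Ω = Ω := by
      ext z
      constructor
      · intro hz; simpa using hs _ hz
      · intro hz; exact hs _ hz
    have h2 := (Homeomorph.neg (EuclideanSpace ℝ (Fin N))).preimage_frontier Ω
    rw [h1] at h2
    rw [← h2] at hx
    exact hx
  have hfr : frontier (e.symm ⁻¹' Ω) = e.symm ⁻¹' frontier Ω :=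
    (e.symm.toHomeomorph.preimage_frontier Ω).symm
  refine no_odd (Ω := e.symm ⁻¹' Ω) (ho.preimage e.symm.continuous) ?_ ?_ ?_ m hm
    (fun x => G (e.symm x) - G (-(e.symm x))) ?_ ?_ ?_
  · have h1 : e.symm ⁻¹' Ω = e '' Ω := by
      ext z
      simp only [mem_preimage, mem_image]
      exact ⟨fun hz => ⟨_, hz, by simp⟩, by rintro ⟨x, hx, rfl⟩; simpa using hx⟩
    rw [h1]
    exact e.lipschitz.isBounded_image hb
  · intro x hx
    simp only [mem_preimage, map_neg]
    exact hs _ hx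
  · simpa using h0
  · fun_prop
  · intro x
    simp only [map_neg, neg_neg, neg_sub]
  · intro x hx
    rw [hfr] at hx
    have hx' : e.symm x ∈ frontier Ω := hx
    rw [hG' _ hx', hG' _ (hfs _ hx'), hodd _ hx', map_neg, sub_neg_eq_add]
    intro h
    rw [← two_smul ℝ, smul_eq_zero] at h
    rcases h with h | h
    · norm_num at h
    · exact hne _ hx' (by simpa using h)

end
end Fan

theorem stmt17 (N : ℕ) (hN : 1 ≤ N) (Ω : Set (EuclideanSpace ℝ (Fin N)))
    (hopen : IsOpen Ω) (hbdd : Bornology.IsBounded Ω)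
    (hsym : ∀ x ∈ Ω, -x ∈ Ω) (h0 : (0 : EuclideanSpace ℝ (Fin N)) ∈ Ω) :
    krasnoselskiiGenus (frontier Ω) = N := by
  have hne : frontier Ω ≠ ∅ := by
    rw [Ne, frontier_eq_empty_iff, not_or]
    refine ⟨fun h => by simp [h] at h0, fun h => ?_⟩
    have : Nonempty (Fin N) := ⟨⟨0, hN⟩⟩
    rw [h] at hbdd
    exact NormedSpace.unbounded_univ ℝ (EuclideanSpace ℝ (Fin N)) hbdd
  rw [krasnoselskiiGenus, if_neg hne]
  apply le_antisymm
  · refine sInf_le ⟨N, rfl, hN, id, continuousOn_id, fun x _ => rfl, ?_⟩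
    rintro x hx rfl
    rw [hopen.frontier_eq] at hx
    exact hx.2 h0
  · refine le_sInf ?_
    rintro k ⟨n, rfl, _, f, hf, hodd, hfne⟩
    by_contra hlt
    have hlt' : n < N := by
      rw [not_le] at hlt
      exact_mod_cast hlt
    exact Fan.no_odd_euclid Ω hopen hbdd hsym h0 n hlt' f hf hodd hfne
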